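/- arXiv:2010.00119 — 2 statements merged into one kernel-verified Lean document; each statement's English description precedes it below -/
import Mathlib

section
/- For every K > 0 there exist constants d = d(K) and f = f(K) such that for every finite nonempty set A ⊂ ℤ² with |A + A| ≤ K·|A|, there exists a proper arithmetic progression P ⊂ ℤ² containing A of dimension at most d(K) and size at most f(K)·|A|. -/
open scoped Pointwise

namespace FZ

lemma lift_bound {E : Type} [NormedAddCommGroup E] [NormedSpace ℝ E] (Γ : AddSubgroup E)
    (u : E) (hu : u ∈ Γ) (y : E) (hy : y ∈ Γ) (ε : ℝ) (hε : 0 < ε) :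
    ∃ z ∈ Γ, (Submodule.Quotient.mk z : E ⧸ (Submodule.span ℝ {u})) = Submodule.Quotient.mk y ∧
      ‖z‖ ≤ ‖(Submodule.Quotient.mk y : E ⧸ (Submodule.span ℝ {u}))‖ + ‖u‖ / 2 + ε := by
  obtain ⟨w, hw, hwn⟩ := Submodule.Quotient.norm_mk_lt
    (Submodule.Quotient.mk y : E ⧸ (Submodule.span ℝ {u})) hε
  rw [Submodule.Quotient.eq, Submodule.mem_span_singleton] at hw
  obtain ⟨t, ht⟩ := hw
  refine ⟨y + (round t) • u, Γ.add_mem hy (Γ.zsmul_mem hu _), ?_, ?_⟩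
  · rw [Submodule.Quotient.eq, Submodule.mem_span_singleton]
    exact ⟨(round t : ℝ), by rw [Int.cast_smul_eq_zsmul]; simp⟩
  · have h1 : y + (round t) • u = w + ((round t : ℝ) - t) • u := by
      rw [sub_smul, ht, ← Int.cast_smul_eq_zsmul ℝ]; abel
    have h2 : ‖((round t : ℝ) - t) • u‖ ≤ ‖u‖ / 2 := by
      rw [norm_smul, Real.norm_eq_abs, abs_sub_comm]
      have := abs_sub_round t
      nlinarith [norm_nonneg u]
    rw [h1]
    linarith [norm_add_le w (((round t : ℝ) - t) • u)]

theorem lattice_gap (n : ℕ) : ∃ C : ℕ, ∀ (E : Type) [NormedAddCommGroup E] [NormedSpace ℝ E]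
    [FiniteDimensional ℝ E] (Γ : AddSubgroup E), Module.finrank ℝ E ≤ n →
    (∀ R : ℝ, {x | x ∈ Γ ∧ ‖x‖ ≤ R}.Finite) →
    ∃ (m : ℕ) (e : Fin m → E) (L : Fin m → ℕ), m ≤ n ∧ (∀ i, e i ∈ Γ) ∧ (∀ i, 1 ≤ L i) ∧
      LinearIndependent ℝ e ∧
      (∀ x ∈ Γ, ‖x‖ ≤ 1 → ∃ l : Fin m → ℤ, (∀ i, |l i| ≤ L i) ∧ x = ∑ i, l i • e i) ∧
      ∑ i, (L i : ℝ) * ‖e i‖ ≤ C := by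
  induction n with
  | zero =>
    refine ⟨0, fun E _ _ _ Γ hr hf => ⟨0, Fin.elim0, Fin.elim0, le_rfl, fun i => i.elim0,
      fun i => i.elim0, linearIndependent_empty_type, ?_, by simp⟩⟩
    intro x _ _
    have := Module.finrank_zero_iff.mp (Nat.le_zero.mp hr)
    exact ⟨Fin.elim0, fun i => i.elim0, Subsingleton.elim _ _⟩
  | succ n ih =>
    obtain ⟨C, hC⟩ := ih
    refine ⟨1 + 6 * C, fun E _ _ _ Γ hr hf => ?_⟩
    by_cases hne : ∃ x ∈ Γ, ‖x‖ ≤ 1 ∧ x ≠ 0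
    swap
    · refine ⟨0, Fin.elim0, Fin.elim0, Nat.zero_le _, fun i => i.elim0,
        fun i => i.elim0, linearIndependent_empty_type, ?_, by simp; positivity⟩
      intro x hx hx1
      refine ⟨Fin.elim0, fun i => i.elim0, ?_⟩
      by_contra h
      exact hne ⟨x, hx, hx1, by simpa using h⟩
    -- smallest vector
    have hfin : {x | x ∈ Γ ∧ ‖x‖ ≤ 1 ∧ x ≠ 0}.Finite :=
      (hf 1).subset (fun x hx => ⟨hx.1, hx.2.1⟩)
    obtain ⟨u, ⟨huΓ, hu1, hu0⟩, humin⟩ := Set.exists_min_image _ (fun x : E => ‖x‖) hfin hne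
    have hmin : ∀ x ∈ Γ, x ≠ 0 → ‖u‖ ≤ ‖x‖ := by
      intro x hx hx0
      by_cases h : ‖x‖ ≤ 1
      · exact humin x ⟨hx, h, hx0⟩
      · linarith
    have hupos : 0 < ‖u‖ := norm_pos_iff.mpr hu0
    set S := Submodule.span ℝ {u} with hS
    have : IsClosed (S : Set E) := Submodule.closed_of_finiteDimensional S
    let Γ' : AddSubgroup (E ⧸ S) := Γ.map (S.mkQ : E →+ E ⧸ S)
    have hrank : Module.finrank ℝ (E ⧸ S) ≤ n := by
      have h1 := Submodule.finrank_quotient_add_finrank S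
      have h2 : Module.finrank ℝ S = 1 := finrank_span_singleton hu0
      omega
    have hlift : ∀ q ∈ Γ', ∀ ε > 0, ∃ z ∈ Γ, S.mkQ z = q ∧ ‖z‖ ≤ ‖q‖ + ‖u‖ / 2 + ε := by
      rintro q ⟨y, hy, rfl⟩ ε hε
      exact lift_bound Γ u huΓ y hy ε hε
    have hfin' : ∀ R : ℝ, {x | x ∈ Γ' ∧ ‖x‖ ≤ R}.Finite := by
      intro R
      refine ((hf (R + ‖u‖ / 2 + 1)).image S.mkQ).subset ?_
      rintro q ⟨hq, hqR⟩
      obtain ⟨z, hz, hzq, hzn⟩ := hlift q hq 1 one_pos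
      exact ⟨z, ⟨hz, by linarith⟩, hzq⟩
    have hlow : ∀ q ∈ Γ', q ≠ 0 → ‖u‖ / 2 ≤ ‖q‖ := by
      intro q hq hq0
      refine le_of_forall_pos_le_add fun ε hε => ?_
      obtain ⟨z, hz, hzq, hzn⟩ := hlift q hq ε hε
      have : z ≠ 0 := by rintro rfl; exact hq0 (by rw [← hzq, map_zero])
      linarith [hmin z hz this]
    obtain ⟨m, e', L', hm, he', hL', hli, hcov, hsum⟩ := hC (E ⧸ S) Γ' hrank hfin'
    have hlift2 : ∀ i, ∃ z ∈ Γ, S.mkQ z = e' i ∧ ‖z‖ ≤ 3 * ‖e' i‖ := by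
      intro i
      obtain ⟨z, hz, hzq, hzn⟩ := hlift (e' i) (he' i) (‖u‖ / 2) (by linarith)
      exact ⟨z, hz, hzq, by linarith [hlow (e' i) (he' i) (hli.ne_zero i)]⟩
    choose e heΓ heq hen using hlift2
    have hsum2 : ∑ i, (L' i : ℝ) * ‖e i‖ ≤ 3 * C := by
      calc ∑ i, (L' i : ℝ) * ‖e i‖ ≤ ∑ i, (L' i : ℝ) * (3 * ‖e' i‖) := by
            gcongr with i; exact hen i
        _ = 3 * ∑ i, (L' i : ℝ) * ‖e' i‖ := by rw [Finset.mul_sum]; congr 1; ext; ring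
        _ ≤ _ := by linarith
    have hli2 : LinearIndependent ℝ e := by
      apply LinearIndependent.of_comp S.mkQ
      have h0 : S.mkQ ∘ e = e' := funext heq
      rw [h0]; exact hli
    set L0 : ℕ := ⌊(1 + 3 * C) / ‖u‖⌋₊ with hL0
    refine ⟨m + 1, Fin.cons u e, Fin.cons L0 L', by omega, ?_, ?_, ?_, ?_, ?_⟩
    · intro i; refine Fin.cases ?_ (fun i => ?_) i
      · simpa using huΓ
      · simpa using heΓ i
    · intro i; refine Fin.cases ?_ (fun i => ?_) i
      · simp only [Fin.cons_zero]
        rw [hL0, Nat.one_le_floor_iff, le_div_iff₀ hupos]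
        have : (0 : ℝ) ≤ C := by positivity
        linarith
      · simpa using hL' i
    · rw [linearIndependent_finCons]
      refine ⟨hli2, fun hmem => ?_⟩
      rw [Submodule.mem_span_range_iff_exists_fun] at hmem
      obtain ⟨c, hc⟩ := hmem
      have h1 : ∑ i, c i • e' i = 0 := by
        have := congrArg S.mkQ hc
        rw [map_sum] at this
        simp only [map_smul, heq] at this
        rw [this, Submodule.mkQ_apply, Submodule.Quotient.mk_eq_zero]
        exact Submodule.mem_span_singleton_self u
      have h2 := Fintype.linearIndependent_iff.mp hli c h1
      apply hu0
      rw [← hc]; simp [h2]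
    · intro x hx hx1
      obtain ⟨l, hl, hxl⟩ := hcov (S.mkQ x) ⟨x, hx, rfl⟩
        ((Submodule.Quotient.norm_mk_le S x).trans hx1)
      have hdiff : x - ∑ i, l i • e i ∈ S := by
        rw [← Submodule.Quotient.mk_eq_zero, ← Submodule.mkQ_apply, map_sub, map_sum, hxl]
        simp [heq]
      obtain ⟨t, ht⟩ := Submodule.mem_span_singleton.mp hdiff
      have hyΓ : x - ∑ i, l i • e i ∈ Γ :=
        Γ.sub_mem hx (Γ.sum_mem fun i _ => Γ.zsmul_mem (heΓ i) _)
      have hround : t = (round t : ℝ) := by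
        by_contra hne
        have hz : (t - round t) • u ∈ Γ := by
          rw [sub_smul, ht, Int.cast_smul_eq_zsmul]
          exact Γ.sub_mem hyΓ (Γ.zsmul_mem huΓ _)
        have := hmin _ hz (smul_ne_zero (sub_ne_zero.mpr hne) hu0)
        rw [norm_smul, Real.norm_eq_abs] at this
        nlinarith [abs_sub_round t]
      have hnorm : ‖x - ∑ i, l i • e i‖ ≤ 1 + 3 * C := by
        refine (norm_sub_le _ _).trans ?_
        have : ‖∑ i, l i • e i‖ ≤ ∑ i, (L' i : ℝ) * ‖e i‖ := by
          refine (norm_sum_le _ _).trans (Finset.sum_le_sum fun i _ => ?_)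
          rw [← Int.cast_smul_eq_zsmul ℝ, norm_smul, Real.norm_eq_abs]
          gcongr
          exact_mod_cast hl i
        linarith
      refine ⟨Fin.cons (round t) l, ?_, ?_⟩
      · intro i; refine Fin.cases ?_ (fun i => ?_) i
        · simp only [Fin.cons_zero]
          rw [← ht, norm_smul, Real.norm_eq_abs, ← le_div_iff₀ hupos, hround] at hnorm
          have h3 : ((round t).natAbs : ℝ) ≤ (1 + 3 * C) / ‖u‖ := by
            rw [Nat.cast_natAbs, Int.cast_abs]; exact hnorm
          have h5 : (round t).natAbs ≤ L0 := Nat.le_floor h3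
          rw [Int.abs_eq_natAbs]
          exact Int.ofNat_le.mpr h5
        · simpa using hl i
      · rw [Fin.sum_univ_succ]
        simp only [Fin.cons_zero, Fin.cons_succ]
        rw [← Int.cast_smul_eq_zsmul ℝ, ← hround, ht]; abel
    · rw [Fin.sum_univ_succ]
      simp only [Fin.cons_zero, Fin.cons_succ]
      have h4 : (L0 : ℝ) * ‖u‖ ≤ 1 + 3 * C := by
        rw [← le_div_iff₀ hupos]
        exact Nat.floor_le (by positivity)
      push_cast
      linarith

end FZ


namespace FZ

noncomputable def box {m : ℕ} (L : Fin m → ℕ) : Finset (Fin m → ℤ) :=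
  Fintype.piFinset (fun i => Finset.Icc (-(L i : ℤ)) (L i))

lemma mem_box {m : ℕ} {L : Fin m → ℕ} {l : Fin m → ℤ} : l ∈ box L ↔ ∀ i, |l i| ≤ L i := by
  simp [box, abs_le]

lemma card_box {m : ℕ} (L : Fin m → ℕ) : (box L).card = ∏ i, (2 * L i + 1) := by
  rw [box, Fintype.card_piFinset]
  congr 1; ext i
  rw [Int.card_Icc]; omega

/-- One reduction step: a nontrivial relation lowers the dimension. -/
theorem reduce_step (d : ℕ) : ∃ F : ℕ, ∀ (v : Fin (d + 1) → ℤ × ℤ) (L : Fin (d + 1) → ℕ),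
    (∀ i, 1 ≤ L i) → ∀ r : Fin (d + 1) → ℤ, r ≠ 0 → (∀ i, |r i| ≤ 2 * L i) →
    ∑ i, r i • v i = 0 →
    ∃ (m : ℕ) (v' : Fin m → ℤ × ℤ) (L' : Fin m → ℕ), m ≤ d ∧ (∀ i, 1 ≤ L' i) ∧
      (∀ l ∈ box L, ∃ l' ∈ box L', ∑ i, l i • v i = ∑ i, l' i • v' i) ∧
      ∏ i, (2 * L' i + 1) ≤ F * ∏ i, (2 * L i + 1) := by
  obtain ⟨C, hC⟩ := lattice_gap d
  refine ⟨(C + 3) ^ (d + 1), fun v L hL r hr0 hr hrel => ?_⟩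
  have hLpos : ∀ i, (0 : ℝ) < L i := fun i => by exact_mod_cast hL i
  -- embedding of the integer lattice
  let ι : (Fin (d + 1) → ℤ) →+ (Fin (d + 1) → ℝ) :=
    { toFun := fun z i => (z i : ℝ) / L i
      map_zero' := by ext i; simp
      map_add' := by intro x y; ext i; simp [add_div] }
  have hι : ∀ z i, ι z i = (z i : ℝ) / L i := fun z i => rfl
  have hιinj : Function.Injective ι := by
    intro x y h
    ext i
    have := congrFun h i
    rw [hι, hι, div_left_inj' (hLpos i).ne'] at this
    exact_mod_cast this
  let Γ : AddSubgroup (Fin (d + 1) → ℝ) := ι.range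
  have hnorm : ∀ (z : Fin (d + 1) → ℤ) (R : ℕ), ‖ι z‖ ≤ R ↔ z ∈ box (fun i => R * L i) := by
    intro z R
    rw [pi_norm_le_iff_of_nonneg (by positivity), mem_box]
    refine forall_congr' fun i => ?_
    rw [hι, Real.norm_eq_abs, abs_div, abs_of_pos (hLpos i), div_le_iff₀ (hLpos i)]
    constructor <;> intro h <;> exact_mod_cast h
  let u : (Fin (d + 1) → ℝ) := ι r
  have huΓ : u ∈ Γ := ⟨r, rfl⟩
  have hu0 : u ≠ 0 := fun h => hr0 (hιinj (by rw [map_zero]; exact h))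
  have hu2 : ‖u‖ ≤ 2 := by
    have := (hnorm r 2).mpr (mem_box.mpr fun i => by exact_mod_cast hr i)
    exact_mod_cast this
  have hf : ∀ R : ℝ, {x | x ∈ Γ ∧ ‖x‖ ≤ R}.Finite := by
    intro R
    refine ((box (fun i => ⌈R⌉₊ * L i)).finite_toSet.image ι).subset ?_
    rintro _ ⟨⟨z, rfl⟩, hz⟩
    exact ⟨z, (hnorm z _).mp (hz.trans (Nat.le_ceil R)), rfl⟩
  set S := Submodule.span ℝ {u} with hS
  have : IsClosed (S : Set (Fin (d + 1) → ℝ)) := Submodule.closed_of_finiteDimensional S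
  let Γ' : AddSubgroup ((Fin (d + 1) → ℝ) ⧸ S) := Γ.map (S.mkQ : (Fin (d + 1) → ℝ) →+ (Fin (d + 1) → ℝ) ⧸ S)
  have hrank : Module.finrank ℝ ((Fin (d + 1) → ℝ) ⧸ S) ≤ d := by
    have h1 := Submodule.finrank_quotient_add_finrank S
    have h2 : Module.finrank ℝ S = 1 := finrank_span_singleton hu0
    have h3 : Module.finrank ℝ (Fin (d + 1) → ℝ) = d + 1 := by simp
    omega
  have hlift : ∀ q ∈ Γ', ∃ z : Fin (d + 1) → ℤ, S.mkQ (ι z) = q ∧ ‖ι z‖ ≤ ‖q‖ + 3 := by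
    rintro q ⟨y, hy, rfl⟩
    obtain ⟨_, ⟨z, rfl⟩, hz1, hz2⟩ := lift_bound Γ u huΓ y hy 1 one_pos
    refine ⟨z, hz1, hz2.trans ?_⟩
    have : ‖(Submodule.Quotient.mk y : (Fin (d + 1) → ℝ) ⧸ S)‖ + ‖u‖ / 2 + 1
      ≤ ‖(Submodule.Quotient.mk y : (Fin (d + 1) → ℝ) ⧸ S)‖ + 3 := by linarith
    exact this
  have hfin' : ∀ R : ℝ, {x | x ∈ Γ' ∧ ‖x‖ ≤ R}.Finite := by
    intro R
    refine ((hf (R + 3)).image S.mkQ).subset ?_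
    rintro q ⟨hq, hqR⟩
    obtain ⟨z, hzq, hzn⟩ := hlift q hq
    exact ⟨ι z, ⟨⟨z, rfl⟩, by linarith⟩, hzq⟩
  obtain ⟨m, e, L', hm, he, hL', hli, hcov, hsum⟩ := hC ((Fin (d + 1) → ℝ) ⧸ S) Γ' hrank hfin'
  choose z hz1 hz2 using fun i => hlift (e i) (he i)
  let φ : (Fin (d + 1) → ℤ) →+ ℤ × ℤ :=
    { toFun := fun l => ∑ i, l i • v i
      map_zero' := by simp
      map_add' := by intro x y; simp [add_smul, Finset.sum_add_distrib] }
  have hφ : ∀ l, φ l = ∑ i, l i • v i := fun l => rfl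
  refine ⟨m, fun i => φ (z i), L', hm, hL', ?_, ?_⟩
  · intro l hl
    have hl1 : ‖ι l‖ ≤ 1 := by
      have := (hnorm l 1).mpr (by simpa using hl)
      simpa using this
    obtain ⟨l', hl', hx⟩ := hcov (S.mkQ (ι l)) ⟨ι l, ⟨l, rfl⟩, rfl⟩
      ((Submodule.Quotient.norm_mk_le S _).trans hl1)
    refine ⟨l', mem_box.mpr hl', ?_⟩
    let w := l - ∑ i, l' i • z i
    have hw : ι w ∈ S := by
      rw [← Submodule.Quotient.mk_eq_zero, ← Submodule.mkQ_apply, map_sub, map_sub, map_sum,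
        map_sum, hx, sub_eq_zero]
      refine Finset.sum_congr rfl fun i _ => ?_
      rw [map_zsmul, map_zsmul, hz1]
    obtain ⟨t, ht⟩ := Submodule.mem_span_singleton.mp hw
    have ht' : ∀ i, t * r i = w i := by
      intro i
      have := congrFun ht i
      simp only [Pi.smul_apply, smul_eq_mul, u, hι] at this
      rw [mul_div_assoc', div_left_inj' (hLpos i).ne'] at this
      exact this
    obtain ⟨j, hj⟩ : ∃ j, r j ≠ 0 := by
      by_contra h; push Not at h; exact hr0 (funext h)
    have hww : r j • w = w j • r := by
      ext i
      have h1 := ht' i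
      have h2 := ht' j
      have : (r j : ℝ) * w i = w j * r i := by rw [← h1, ← h2]; ring
      simp only [Pi.smul_apply, smul_eq_mul]
      exact_mod_cast this
    have hφw : φ w = 0 := by
      have h1 : r j • φ w = 0 := by
        rw [← map_zsmul, hww, map_zsmul, hφ r, hrel, smul_zero]
      exact (smul_eq_zero.mp h1).resolve_left hj
    have : φ l = ∑ i, l' i • φ (z i) := by
      rw [map_sub, map_sum, sub_eq_zero] at hφw
      rw [hφw]
      refine Finset.sum_congr rfl fun i _ => ?_
      rw [map_zsmul]
    exact this
  · rw [← card_box, ← card_box]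
    have hpt : ∀ l : Fin m → ℤ, ∃ y : Fin (d + 1) → ℤ, S.mkQ (ι y) = ∑ i, l i • e i ∧
        ‖ι y‖ ≤ ‖∑ i, l i • e i‖ + 3 := by
      intro l
      exact hlift _ (Γ'.sum_mem fun i _ => Γ'.zsmul_mem (he i) _)
    choose y hy1 hy2 using hpt
    have hcard : (box L').card ≤ (box (fun i => (C + 3) * L i)).card := by
      refine Finset.card_le_card_of_injOn y ?_ ?_
      · intro l hl
        refine (hnorm _ (C + 3)).mp ((hy2 l).trans ?_)
        have : ‖∑ i, l i • e i‖ ≤ ∑ i, (L' i : ℝ) * ‖e i‖ := by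
          refine (norm_sum_le _ _).trans (Finset.sum_le_sum fun i _ => ?_)
          rw [← Int.cast_smul_eq_zsmul ℝ, norm_smul, Real.norm_eq_abs]
          gcongr
          exact_mod_cast mem_box.mp hl i
        push_cast
        linarith
      · intro l _ l' _ h
        have h1 : ∑ i, l i • e i = ∑ i, l' i • e i := by rw [← hy1, ← hy1, h]
        have h2 : ∑ i, ((l i : ℝ) - l' i) • e i = 0 := by
          simp only [sub_smul, Int.cast_smul_eq_zsmul, Finset.sum_sub_distrib]
          rw [h1, sub_self]
        have h3 := Fintype.linearIndependent_iff.mp hli _ h2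
        ext i
        have := sub_eq_zero.mp (h3 i)
        exact_mod_cast this
    refine hcard.trans ?_
    rw [card_box, card_box]
    calc ∏ i, (2 * ((C + 3) * L i) + 1) ≤ ∏ i, ((C + 3) * (2 * L i + 1)) := by
          gcongr with i; nlinarith
      _ = _ := by rw [Finset.prod_mul_distrib]; simp

theorem make_proper (d : ℕ) : ∃ F : ℕ, ∀ d' ≤ d, ∀ (v : Fin d' → ℤ × ℤ) (L : Fin d' → ℕ),
    (∀ i, 1 ≤ L i) →
    ∃ (m : ℕ) (v' : Fin m → ℤ × ℤ) (L' : Fin m → ℕ), m ≤ d ∧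
      (∀ l ∈ box L', ∀ l' ∈ box L', ∑ i, l i • v' i = ∑ i, l' i • v' i → l = l') ∧
      (∀ l ∈ box L, ∃ l' ∈ box L', ∑ i, l i • v i = ∑ i, l' i • v' i) ∧
      ∏ i, (2 * L' i + 1) ≤ F * ∏ i, (2 * L i + 1) := by
  induction d with
  | zero =>
    refine ⟨1, fun d' hd' v L hL => ?_⟩
    obtain rfl : d' = 0 := by omega
    exact ⟨0, v, L, le_rfl, fun _ _ _ _ _ => Subsingleton.elim _ _, fun l hl => ⟨l, hl, rfl⟩,
      by simp⟩
  | succ d ih =>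
    obtain ⟨F, hF⟩ := ih
    obtain ⟨G, hG⟩ := reduce_step d
    refine ⟨F * G + F + 1, fun d' hd' v L hL => ?_⟩
    rcases Nat.lt_or_ge d d' with hlt | hge
    swap
    · obtain ⟨m, v', L', h1, h2, h3, h4⟩ := hF d' hge v L hL
      exact ⟨m, v', L', by omega, h2, h3, h4.trans (Nat.mul_le_mul_right _ (by nlinarith))⟩
    obtain rfl : d' = d + 1 := by omega
    by_cases hp : ∀ l ∈ box L, ∀ l' ∈ box L, ∑ i, l i • v i = ∑ i, l' i • v i → l = l'
    · exact ⟨d + 1, v, L, le_rfl, hp, fun l hl => ⟨l, hl, rfl⟩,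
        Nat.le_mul_of_pos_left _ (by omega)⟩
    push Not at hp
    obtain ⟨l, hl, l', hl', heq, hne⟩ := hp
    obtain ⟨m, v', L', h1, h2, h3, h4⟩ := hG v L hL (l - l') (sub_ne_zero.mpr hne)
      (fun i => by
        have h5 := mem_box.mp hl i
        have h6 := mem_box.mp hl' i
        have := abs_sub (l i) (l' i)
        simp only [Pi.sub_apply]
        linarith)
      (by simp only [Pi.sub_apply, sub_smul, Finset.sum_sub_distrib, heq, sub_self])
    obtain ⟨m', v'', L'', k1, k2, k3, k4⟩ := hF m h1 v' L' h2
    refine ⟨m', v'', L'', by omega, k2, ?_, ?_⟩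
    · intro a ha
      obtain ⟨b, hb, hab⟩ := h3 a ha
      obtain ⟨c, hc, hbc⟩ := k3 b hb
      exact ⟨c, hc, hab.trans hbc⟩
    · calc _ ≤ F * _ := k4
        _ ≤ F * (G * _) := Nat.mul_le_mul_left _ h4
        _ = (F * G) * _ := by ring
        _ ≤ _ := Nat.mul_le_mul_right _ (by omega)

end FZ


namespace FZ

/-- Bogolyubov's lemma in `ZMod N`. -/
theorem bogolyubov (N : ℕ) [NeZero N] (A : Finset (ZMod N)) (hA : A.Nonempty) (D : ℕ)
    (hD : N ≤ D * A.card) :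
    ∃ R : Finset (ZMod N), R.card ≤ 2 * D ^ 2 ∧
      ∀ x : ZMod N, (∀ r ∈ R, 0 ≤ (ZMod.stdAddChar (r * x)).re) →
        ∃ a ∈ A, ∃ b ∈ A, ∃ c ∈ A, ∃ d ∈ A, x = a + b - c - d := by
  classical
  set ψ : AddChar (ZMod N) ℂ := ZMod.stdAddChar with hψ
  have hprim : ψ.IsPrimitive := ZMod.isPrimitive_stdAddChar N
  have horth : ∀ y : ZMod N, ∑ r, ψ (r * y) = if y = 0 then (N : ℂ) else 0 := by
    intro y
    rw [AddChar.sum_mulShift y hprim]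
    split_ifs <;> simp [ZMod.card]
  have hnorm1 : ∀ y, ‖ψ y‖ = 1 := fun y => AddChar.norm_apply ψ y
  have hconj : ∀ y, (starRingEnd ℂ) (ψ y) = ψ (-y) := fun y => (AddChar.map_neg_eq_conj ψ y).symm
  let h : ZMod N → ℂ := fun r => ∑ a ∈ A, ψ (r * a)
  have hF : ∀ r, ((‖h r‖ ^ 2 : ℝ) : ℂ) = ∑ a ∈ A, ∑ b ∈ A, ψ (r * (a - b)) := by
    intro r
    have : ((‖h r‖ ^ 2 : ℝ) : ℂ) = h r * (starRingEnd ℂ) (h r) := by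
      rw [Complex.mul_conj, Complex.normSq_eq_norm_sq]
    rw [this]
    simp only [h, map_sum, Finset.sum_mul_sum, hconj]
    refine Finset.sum_congr rfl fun a _ => Finset.sum_congr rfl fun b _ => ?_
    rw [← AddChar.map_add_eq_mul]; congr 1; ring
  have hparseval : ∑ r, ‖h r‖ ^ 2 = N * A.card := by
    have : ((∑ r, ‖h r‖ ^ 2 : ℝ) : ℂ) = ((N * A.card : ℝ) : ℂ) := by
      rw [Complex.ofReal_sum]
      simp only [hF]
      rw [Finset.sum_comm]
      have h1 : ∀ a ∈ A, ∑ r, ∑ b ∈ A, ψ (r * (a - b)) = N := by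
        intro a ha
        rw [Finset.sum_comm]
        simp only [horth, sub_eq_zero]
        simp [ha]
      rw [Finset.sum_congr rfl h1]
      simp [mul_comm]
    exact_mod_cast this
  have hApos : (0 : ℝ) < A.card := by exact_mod_cast hA.card_pos
  have hNpos : (0 : ℝ) < N := by exact_mod_cast Nat.pos_of_ne_zero (NeZero.ne N)
  have hDR : (N : ℝ) ≤ D * A.card := by exact_mod_cast hD
  have hDpos : (1 : ℝ) ≤ D := by
    have : 1 ≤ D := by
      by_contra hh
      have : D = 0 := by omega
      subst this
      exact NeZero.ne N (by omega)
    exact_mod_cast this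
  let R : Finset (ZMod N) := Finset.univ.filter fun r => (A.card : ℝ) ^ 2 ≤ 2 * D * ‖h r‖ ^ 2
  refine ⟨R, ?_, ?_⟩
  · have h1 : (R.card : ℝ) * (A.card : ℝ) ^ 2 ≤ 2 * D * (N * A.card) := by
      rw [← hparseval, Finset.mul_sum, ← nsmul_eq_mul]
      calc R.card • (A.card : ℝ) ^ 2 ≤ ∑ r ∈ R, 2 * D * ‖h r‖ ^ 2 :=
            Finset.card_nsmul_le_sum _ _ _ (fun r hr => (Finset.mem_filter.mp hr).2)
        _ ≤ _ := Finset.sum_le_sum_of_subset_of_nonneg (Finset.subset_univ _)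
            (fun _ _ _ => by positivity)
    have h2 : (R.card : ℝ) * (A.card : ℝ) ^ 2 ≤ (2 * D ^ 2) * (A.card : ℝ) ^ 2 := by
      refine h1.trans ?_
      have : 2 * D * (N * A.card) ≤ 2 * D * ((D * A.card) * A.card : ℝ) := by gcongr
      linarith
    have h3 := le_of_mul_le_mul_right h2 (by positivity)
    exact_mod_cast h3
  · intro x hx
    by_contra hno
    push Not at hno
    have hzero : ∑ r, ((‖h r‖ ^ 2 : ℝ) : ℂ) ^ 2 * ψ (r * x) = 0 := by
      have h1 : ∀ r, ((‖h r‖ ^ 2 : ℝ) : ℂ) ^ 2 * ψ (r * x) =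
          ∑ a ∈ A, ∑ b ∈ A, ∑ c ∈ A, ∑ d ∈ A, ψ (r * (a - b + (c - d) + x)) := by
        intro r
        rw [hF, sq, Finset.sum_mul, Finset.sum_mul]
        refine Finset.sum_congr rfl fun a _ => ?_
        rw [Finset.sum_mul, Finset.sum_mul]
        refine Finset.sum_congr rfl fun b _ => ?_
        rw [Finset.mul_sum, Finset.sum_mul]
        refine Finset.sum_congr rfl fun c _ => ?_
        rw [Finset.mul_sum, Finset.sum_mul]
        refine Finset.sum_congr rfl fun d _ => ?_
        rw [← AddChar.map_add_eq_mul, ← AddChar.map_add_eq_mul]; congr 1; ring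
      simp only [h1]
      rw [Finset.sum_comm]
      refine Finset.sum_eq_zero fun a ha => ?_
      rw [Finset.sum_comm]
      refine Finset.sum_eq_zero fun b hb => ?_
      rw [Finset.sum_comm]
      refine Finset.sum_eq_zero fun c hc => ?_
      rw [Finset.sum_comm]
      refine Finset.sum_eq_zero fun d hd => ?_
      rw [horth, if_neg]
      intro h0
      refine hno b hb d hd a ha c hc ?_
      linear_combination h0
    have hre : ∑ r, (‖h r‖ ^ 2) ^ 2 * (ψ (r * x)).re = 0 := by
      have := congrArg Complex.re hzero
      rw [Complex.re_sum] at this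
      simp only [← Complex.ofReal_pow, Complex.re_ofReal_mul, Complex.zero_re] at this
      exact this
    have h0 : h 0 = A.card := by simp [h]
    have hbound : ∀ r, r ≠ 0 → -((A.card : ℝ) ^ 2 / (2 * D) * ‖h r‖ ^ 2) ≤
        (‖h r‖ ^ 2) ^ 2 * (ψ (r * x)).re := by
      intro r _
      by_cases hr : r ∈ R
      · have := hx r hr
        have h3 : 0 ≤ (‖h r‖ ^ 2) ^ 2 * (ψ (r * x)).re := by positivity
        have h4 : 0 ≤ ((A.card : ℝ) ^ 2 / (2 * D) * ‖h r‖ ^ 2) := by positivity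
        linarith
      · have h3 : 2 * D * ‖h r‖ ^ 2 < (A.card : ℝ) ^ 2 := by
          by_contra hh
          exact hr (Finset.mem_filter.mpr ⟨Finset.mem_univ _, not_lt.mp hh⟩)
        have h4 : ‖h r‖ ^ 2 ≤ (A.card : ℝ) ^ 2 / (2 * D) := by
          rw [le_div_iff₀ (by positivity)]; linarith
        have h5 : -1 ≤ (ψ (r * x)).re := by
          have := (abs_le.mp ((Complex.abs_re_le_norm _).trans (hnorm1 (r * x)).le)).1
          exact this
        have h6 : 0 ≤ ‖h r‖ ^ 2 := by positivity
        nlinarith [mul_le_mul_of_nonneg_right h4 h6, mul_nonneg h6 h6]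
    have hsplit := Finset.add_sum_erase Finset.univ
      (fun r => (‖h r‖ ^ 2) ^ 2 * (ψ (r * x)).re) (Finset.mem_univ (0 : ZMod N))
    rw [hre] at hsplit
    simp only [h0, zero_mul, AddChar.map_zero_eq_one, Complex.one_re, mul_one,
      Complex.norm_natCast] at hsplit
    have hsum : -((A.card : ℝ) ^ 2 / (2 * D) * (N * A.card)) + (A.card : ℝ) ^ 2 / (2 * D) *
        (A.card : ℝ) ^ 2 ≤
        ∑ r ∈ Finset.univ.erase (0 : ZMod N), (‖h r‖ ^ 2) ^ 2 * (ψ (r * x)).re := by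
      refine le_trans ?_ (Finset.sum_le_sum fun r hr => hbound r (Finset.ne_of_mem_erase hr))
      rw [Finset.sum_neg_distrib, ← Finset.mul_sum, ← hparseval,
        ← Finset.add_sum_erase Finset.univ (fun r => ‖h r‖ ^ 2) (Finset.mem_univ (0 : ZMod N)), h0,
        Complex.norm_natCast]
      apply le_of_eq; ring
    have h7 : (A.card : ℝ) ^ 2 / (2 * D) * (N * A.card) ≤ (A.card : ℝ) ^ 4 / 2 := by
      rw [div_mul_eq_mul_div, div_le_div_iff₀ (by positivity) (by positivity)]
      have : (A.card : ℝ) ^ 3 * N ≤ (A.card : ℝ) ^ 3 * (D * A.card) := by gcongr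
      nlinarith
    have h8 : 0 < (A.card : ℝ) ^ 4 := by positivity
    have h9 : 0 ≤ (A.card : ℝ) ^ 2 / (2 * D) * (A.card : ℝ) ^ 2 := by positivity
    nlinarith

end FZ


namespace FZ

open Classical in
lemma bad_count (p N : ℕ) [Fact p.Prime] (hN : 0 < N) (c : ZMod p) (hc : c ≠ 0) :
    N * (Finset.univ.filter fun t : ZMod p => t ≠ 0 ∧ ∃ k : ℤ, 2 * N * |k| < p ∧
      ((k * N : ℤ) : ZMod p) = t * c).card ≤ p - 1 := by
  set h : ℕ := (p - 1) / (2 * N) with hh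
  have hp : 1 < p := (Fact.out : p.Prime).one_lt
  have hsub : (Finset.univ.filter fun t : ZMod p => t ≠ 0 ∧ ∃ k : ℤ, 2 * N * |k| < p ∧
      ((k * N : ℤ) : ZMod p) = t * c) ⊆
      ((Finset.Icc (-(h : ℤ)) h).erase 0).image (fun k : ℤ => ((k * N : ℤ) : ZMod p) * c⁻¹) := by
    intro t ht
    obtain ⟨-, ht0, k, hk, hkt⟩ := Finset.mem_filter.mp ht
    refine Finset.mem_image.mpr ⟨k, ?_, ?_⟩
    · refine Finset.mem_erase.mpr ⟨?_, ?_⟩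
      · rintro rfl
        simp only [zero_mul, Int.cast_zero] at hkt
        exact mul_ne_zero ht0 hc hkt.symm
      · rw [Finset.mem_Icc, ← abs_le, Int.abs_eq_natAbs]
        rw [Int.abs_eq_natAbs] at hk
        have hk' : 2 * N * k.natAbs < p := by exact_mod_cast hk
        have : k.natAbs ≤ h := by
          rw [hh, Nat.le_div_iff_mul_le (by positivity)]
          rw [mul_comm]; omega
        exact_mod_cast this
    · rw [hkt, mul_assoc, mul_inv_cancel₀ hc, mul_one]
  have hcard := (Finset.card_le_card hsub).trans Finset.card_image_le
  rw [Finset.card_erase_of_mem (by simp), Int.card_Icc] at hcard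
  have h2 : ((h : ℤ) + 1 - -(h : ℤ)).toNat - 1 = 2 * h := by omega
  rw [h2] at hcard
  calc _ ≤ N * (2 * h) := Nat.mul_le_mul_left _ hcard
    _ = (p - 1) / (2 * N) * (2 * N) := by rw [hh]; ring
    _ ≤ p - 1 := Nat.div_mul_le_self _ _

lemma sum6_mem (A : Finset (ℤ × ℤ)) (a : Fin 6 → ℤ × ℤ) (ha : ∀ i, a i ∈ A) :
    ∑ i, a i ∈ 6 • A := by
  rw [Finset.mem_nsmul]
  exact ⟨fun i => ⟨a i, ha i⟩, by rw [List.sum_ofFn]⟩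

/-- Ruzsa's modelling lemma. -/
theorem modeling (A : Finset (ℤ × ℤ)) (hA : A.Nonempty) :
    ∃ A₁ ⊆ A, A.card ≤ 12 * A₁.card ∧ ∃ π : ℤ × ℤ → ℤ, ∀ a b : Fin 6 → ℤ × ℤ,
      (∀ i, a i ∈ A₁) → (∀ i, b i ∈ A₁) →
      ((((6 • A - 6 • A).card : ℕ) : ℤ) ∣ ∑ i, π (a i) - ∑ i, π (b i) ↔ ∑ i, a i = ∑ i, b i) := by
  classical
  set D := 6 • A - 6 • A with hD
  set N := D.card with hN
  have h0D : (0 : ℤ × ℤ) ∈ D := by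
    have h6 : (6 • A).Nonempty := hA.nsmul
    obtain ⟨y, hy⟩ := h6
    exact Finset.mem_sub.mpr ⟨y, hy, y, hy, sub_self y⟩
  have hNpos : 0 < N := Finset.card_pos.mpr ⟨0, h0D⟩
  obtain ⟨B, hB⟩ : ∃ B : ℕ, ∀ z ∈ D, |z.1| ≤ B ∧ |z.2| ≤ B := by
    refine ⟨D.sup (fun z => z.1.natAbs + z.2.natAbs), fun z hz => ?_⟩
    have := Finset.le_sup (f := fun z : ℤ × ℤ => z.1.natAbs + z.2.natAbs) hz
    rw [Int.abs_eq_natAbs, Int.abs_eq_natAbs]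
    constructor <;> exact_mod_cast (by omega)
  let θ : (ℤ × ℤ) →+ ℤ :=
    { toFun := fun z => z.1 + (2 * B + 1) * z.2
      map_zero' := by simp
      map_add' := by intro x y; simp; ring }
  have hθ : ∀ z, θ z = z.1 + (2 * B + 1) * z.2 := fun z => rfl
  have hθ0 : ∀ z ∈ D, θ z = 0 → z = 0 := by
    intro z hz h
    obtain ⟨h1, h2⟩ := hB z hz
    rw [hθ] at h
    rw [abs_le] at h1 h2
    have hz2 : z.2 = 0 := by
      by_contra hne
      rcases lt_or_gt_of_ne hne with h3 | h3
      · nlinarith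
      · nlinarith
    rw [hz2] at h
    exact Prod.ext (by simpa using h) hz2
  obtain ⟨p, hpB, hpp⟩ := Nat.exists_infinite_primes (B + (2 * B + 1) * B + 1)
  have : Fact p.Prime := ⟨hpp⟩
  have hpp0 : (0 : ℤ) < p := by exact_mod_cast hpp.pos
  have hp1 : 1 < p := hpp.one_lt
  have hθp : ∀ z ∈ D, z ≠ 0 → ((θ z : ℤ) : ZMod p) ≠ 0 := by
    intro z hz hz0 h
    rw [ZMod.intCast_zmod_eq_zero_iff_dvd] at h
    obtain ⟨h1, h2⟩ := hB z hz
    have h3 : |θ z| < p := by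
      rw [hθ]
      refine (abs_add_le _ _).trans_lt ?_
      rw [abs_mul, abs_of_nonneg (by positivity : (0 : ℤ) ≤ 2 * B + 1)]
      have : ((B + (2 * B + 1) * B + 1 : ℕ) : ℤ) ≤ p := by exact_mod_cast hpB
      push_cast at this
      nlinarith
    exact hz0 (hθ0 z hz (Int.eq_zero_of_abs_lt_dvd h h3))
  -- choose the dilation
  let bad : ℤ × ℤ → Finset (ZMod p) := fun z => Finset.univ.filter fun t : ZMod p =>
    t ≠ 0 ∧ ∃ k : ℤ, 2 * N * |k| < p ∧ ((k * N : ℤ) : ZMod p) = t * ((θ z : ℤ) : ZMod p)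
  obtain ⟨t, ht0, ht⟩ : ∃ t : ZMod p, t ≠ 0 ∧ ∀ z ∈ D, z ≠ 0 → t ∉ bad z := by
    by_contra hcon
    push Not at hcon
    have hsub : (Finset.univ.erase (0 : ZMod p)) ⊆ (D.erase 0).biUnion bad := by
      intro t ht
      obtain ⟨z, hz, hz0, hb⟩ := hcon t (Finset.ne_of_mem_erase ht)
      exact Finset.mem_biUnion.mpr ⟨z, Finset.mem_erase.mpr ⟨hz0, hz⟩, hb⟩
    have h1 := (Finset.card_le_card hsub).trans Finset.card_biUnion_le
    rw [Finset.card_erase_of_mem (Finset.mem_univ _), Finset.card_univ, ZMod.card] at h1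
    have h2 : N * (p - 1) ≤ (N - 1) * (p - 1) := by
      calc N * (p - 1) ≤ N * ∑ z ∈ D.erase 0, (bad z).card := Nat.mul_le_mul_left _ h1
        _ = ∑ z ∈ D.erase 0, N * (bad z).card := Finset.mul_sum _ _ _
        _ ≤ ∑ z ∈ D.erase 0, (p - 1) := Finset.sum_le_sum fun z hz =>
            bad_count p N hNpos _ (hθp z (Finset.mem_of_mem_erase hz) (Finset.ne_of_mem_erase hz))
        _ = (N - 1) * (p - 1) := by
            rw [Finset.sum_const, Finset.card_erase_of_mem h0D, smul_eq_mul]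
    have h3 := Nat.le_of_mul_le_mul_right h2 (by omega)
    omega
  let f : ℤ × ℤ → ℤ := fun a => ((t.val : ℤ) * θ a) % p
  have hf0 : ∀ a, 0 ≤ f a := fun a => Int.emod_nonneg _ hpp0.ne'
  have hfp : ∀ a, f a < p := fun a => Int.emod_lt_of_pos _ hpp0
  have hfmod : ∀ a, ((f a : ℤ) : ZMod p) = t * ((θ a : ℤ) : ZMod p) := by
    intro a
    simp only [f]
    rw [ZMod.intCast_mod]
    push_cast
    rw [ZMod.natCast_zmod_val]
  -- choose the slice
  let s : ℤ × ℤ → ℕ := fun a => (12 * f a / p).toNat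
  have hs : ∀ a ∈ A, s a ∈ Finset.range 12 := by
    intro a _
    rw [Finset.mem_range]
    have : 12 * f a / p < 12 := Int.ediv_lt_of_lt_mul hpp0 (by linarith [hfp a])
    simp only [s]
    omega
  obtain ⟨j, hj, hjc⟩ := Finset.exists_le_card_fiber_of_nsmul_le_card_of_maps_to
    (s := A) (t := Finset.range 12) (f := s) (b := (A.card : ℚ) / 12) hs ⟨0, by simp⟩
    (by simp; linarith)
  refine ⟨A.filter fun a => s a = j, Finset.filter_subset _ _, ?_, f, ?_⟩
  · have : (A.card : ℚ) ≤ 12 * (A.filter fun a => s a = j).card := by linarith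
    exact_mod_cast this
  intro a b ha hb
  have hclose : ∀ x ∈ A.filter (fun a => s a = j), (j : ℤ) * p ≤ 12 * f x ∧
      12 * f x < (j + 1) * p := by
    intro x hx
    have h1 := (Finset.mem_filter.mp hx).2
    have h2 : 0 ≤ 12 * f x / p := Int.ediv_nonneg (by linarith [hf0 x]) hpp0.le
    have h3 : 12 * f x / p = j := by simp only [s] at h1; omega
    constructor
    · rw [← h3]; exact Int.ediv_mul_le _ hpp0.ne'
    · rw [← h3]; exact Int.lt_ediv_add_one_mul_self _ hpp0
  set T := ∑ i, f (a i) - ∑ i, f (b i) with hT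
  have hTabs : 2 * |T| < p := by
    have hA6 : ∀ i, _ := fun i => hclose _ (ha i)
    have hB6 : ∀ i, _ := fun i => hclose _ (hb i)
    simp only [hT, Fin.sum_univ_six]
    have h1 := hA6 0; have h2 := hA6 1; have h3 := hA6 2
    have h4 := hA6 3; have h5 := hA6 4; have h6 := hA6 5
    have g1 := hB6 0; have g2 := hB6 1; have g3 := hB6 2
    have g4 := hB6 3; have g5 := hB6 4; have g6 := hB6 5
    have : |f (a 0) + f (a 1) + f (a 2) + f (a 3) + f (a 4) + f (a 5) -
      (f (b 0) + f (b 1) + f (b 2) + f (b 3) + f (b 4) + f (b 5))| * 2 < p := by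
      rw [← abs_of_pos (show (0 : ℤ) < 2 by norm_num), ← abs_mul, abs_lt]
      constructor <;> linarith
    linarith
  have haA : ∀ i, a i ∈ A := fun i => Finset.mem_of_mem_filter _ (ha i)
  have hbA : ∀ i, b i ∈ A := fun i => Finset.mem_of_mem_filter _ (hb i)
  set z := ∑ i, a i - ∑ i, b i with hz
  have hzD : z ∈ D := Finset.sub_mem_sub (sum6_mem A a haA) (sum6_mem A b hbA)
  have hTz : ((T : ℤ) : ZMod p) = t * ((θ z : ℤ) : ZMod p) := by
    rw [hT, hz, map_sub, map_sum, map_sum]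
    push_cast
    simp only [hfmod]
    rw [mul_sub, Finset.mul_sum, Finset.mul_sum]
  constructor
  · rintro ⟨k, hk⟩
    by_contra hne
    have hz0 : z ≠ 0 := sub_ne_zero.mpr hne
    refine ht z hzD hz0 (Finset.mem_filter.mpr ⟨Finset.mem_univ _, ht0, k, ?_, ?_⟩)
    · rw [hk, abs_mul, Nat.abs_cast] at hTabs
      linarith
    · rw [mul_comm k, ← hk, hTz]
  · intro heq
    have hz0 : z = 0 := sub_eq_zero.mpr heq
    rw [hz0, map_zero, Int.cast_zero, mul_zero, ZMod.intCast_zmod_eq_zero_iff_dvd] at hTz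
    have : T = 0 := Int.eq_zero_of_abs_lt_dvd hTz (by linarith [abs_nonneg T])
    rw [this]
    exact dvd_zero _

end FZ


namespace FZ

lemma re_nonneg_of_close (N : ℕ) [NeZero N] (j k : ℤ) (h : |(j : ℝ) / N - k| ≤ 1 / 4) :
    0 ≤ (ZMod.stdAddChar (j : ZMod N)).re := by
  have h1 : ZMod.stdAddChar (j : ZMod N) =
      Complex.exp (((2 * Real.pi * ((j : ℝ) / N) : ℝ) : ℂ) * Complex.I) := by
    rw [ZMod.stdAddChar_coe]; congr 1; push_cast; ring
  rw [h1, Complex.exp_ofReal_mul_I_re]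
  have h2 : Real.cos (2 * Real.pi * ((j : ℝ) / N)) =
      Real.cos (2 * Real.pi * ((j : ℝ) / N - k)) := by
    rw [← Real.cos_sub_int_mul_two_pi _ k]; congr 1; ring
  rw [h2]
  have := Real.pi_pos
  rw [abs_le] at h
  apply Real.cos_nonneg_of_neg_pi_div_two_le_of_le <;> nlinarith

theorem bohr_gap (k : ℕ) : ∃ M : ℕ, ∀ (N : ℕ) [NeZero N] (R : Finset (ZMod N)), R.card ≤ k →
    ∃ (m : ℕ) (t : Fin m → ZMod N) (L : Fin m → ℕ), m ≤ k + 1 ∧ (∀ i, 1 ≤ L i) ∧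
      (∀ l ∈ box L, ∀ r ∈ R, 0 ≤ (ZMod.stdAddChar (r * ∑ i, l i • t i)).re) ∧
      (∀ l ∈ box L, ∀ l' ∈ box L, ∑ i, l i • t i = ∑ i, l' i • t i → l = l') ∧
      N ≤ M * ∏ i, (2 * L i + 1) := by
  classical
  obtain ⟨C, hC⟩ := lattice_gap (k + 1)
  set Q : ℕ := 4 * C + 4 with hQ
  have hQpos : (0 : ℝ) < Q := by rw [hQ]; positivity
  have hQC : (Q : ℝ) = 4 * C + 4 := by rw [hQ]; push_cast; ring
  refine ⟨Q ^ (k + 1), fun N _ R hR => ?_⟩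
  have hNpos : (0 : ℝ) < N := by exact_mod_cast Nat.pos_of_ne_zero (NeZero.ne N)
  let ρ : Option R → ℤ := fun o => o.elim 1 (fun r => (r.1.val : ℤ))
  let ι : (ℤ × (Option R → ℤ)) →+ (Option R → ℝ) :=
    { toFun := fun y o => Q * ((y.1 * ρ o : ℤ) / (N : ℝ) - y.2 o)
      map_zero' := by ext o; simp
      map_add' := by intro x y; ext o; simp; ring }
  have hι : ∀ y o, ι y o = Q * ((y.1 * ρ o : ℤ) / (N : ℝ) - y.2 o) := fun _ _ => rfl
  let Γ : AddSubgroup (Option R → ℝ) := ι.range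
  have hrank : Module.finrank ℝ (Option R → ℝ) ≤ k + 1 := by
    simp; exact hR
  have hf : ∀ B : ℝ, {x | x ∈ Γ ∧ ‖x‖ ≤ B}.Finite := by
    intro B
    let b : ℤ := ⌈B * N / Q⌉
    have hF : ((fun j : ℤ => (Q : ℝ) / N * j) '' (Set.Icc (-b) b)).Finite :=
      (Set.finite_Icc _ _).image _
    refine (Set.Finite.pi' (fun _ : Option R => hF)).subset ?_
    rintro _ ⟨⟨y, rfl⟩, hy⟩ o
    refine ⟨y.1 * ρ o - y.2 o * N, ?_, ?_⟩
    · have h1 := (norm_le_pi_norm (ι y) o).trans hy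
      have h2 : ι y o = Q / N * ((y.1 * ρ o - y.2 o * N : ℤ) : ℝ) := by
        rw [hι]; push_cast; field_simp
      rw [h2, Real.norm_eq_abs, abs_mul, abs_of_pos (by positivity : (0 : ℝ) < Q / N)] at h1
      have h3 : |((y.1 * ρ o - y.2 o * N : ℤ) : ℝ)| ≤ B * N / Q := by
        rw [le_div_iff₀ hQpos]
        rw [div_mul_eq_mul_div, div_le_iff₀ hNpos] at h1
        linarith
      have h4 : |((y.1 * ρ o - y.2 o * N : ℤ) : ℝ)| ≤ b := h3.trans (Int.le_ceil _)
      rw [Set.mem_Icc, ← abs_le]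
      exact_mod_cast h4
    · rw [hι]; push_cast; field_simp
  obtain ⟨m, e, L, hm, he, hL, hli, hcov, hsum⟩ := hC (Option R → ℝ) Γ hrank hf
  choose y hy using he
  have hlin : ∀ l : Fin m → ℤ, ι (∑ i, l i • y i) = ∑ i, l i • e i := by
    intro l
    rw [map_sum]
    refine Finset.sum_congr rfl fun i _ => ?_
    rw [map_zsmul, hy]
  have hfst : ∀ l : Fin m → ℤ, (((∑ i, l i • y i).1 : ℤ) : ZMod N) =
      ∑ i, l i • (((y i).1 : ℤ) : ZMod N) := by
    intro l
    rw [Prod.fst_sum]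
    push_cast
    refine Finset.sum_congr rfl fun i _ => ?_
    simp
  have hbd : ∀ l ∈ box L, ‖∑ i, l i • e i‖ ≤ C := by
    intro l hl
    refine (norm_sum_le _ _).trans (le_trans (Finset.sum_le_sum fun i _ => ?_) hsum)
    rw [← Int.cast_smul_eq_zsmul ℝ, norm_smul, Real.norm_eq_abs]
    gcongr
    exact_mod_cast mem_box.mp hl i
  have hinj : ∀ l l' : Fin m → ℤ, ∑ i, l i • e i = ∑ i, l' i • e i → l = l' := by
    intro l l' h1
    have h2 : ∑ i, ((l i : ℝ) - l' i) • e i = 0 := by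
      simp only [sub_smul, Int.cast_smul_eq_zsmul, Finset.sum_sub_distrib]
      rw [h1, sub_self]
    have h3 := Fintype.linearIndependent_iff.mp hli _ h2
    ext i
    have := sub_eq_zero.mp (h3 i)
    exact_mod_cast this
  refine ⟨m, fun i => (((y i).1 : ℤ) : ZMod N), L, hm, hL, ?_, ?_, ?_⟩
  · intro l hl r hr
    rw [← hfst]
    have h1 := (norm_le_pi_norm _ (some ⟨r, hr⟩)).trans (hbd l hl)
    rw [← hlin, hι, Real.norm_eq_abs, abs_mul, abs_of_pos hQpos] at h1
    have h2 : r * (((∑ i, l i • y i).1 : ℤ) : ZMod N) =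
        (((∑ i, l i • y i).1 * ρ (some ⟨r, hr⟩) : ℤ) : ZMod N) := by
      simp only [ρ, Option.elim]
      push_cast
      rw [ZMod.natCast_zmod_val, mul_comm]
    rw [h2]
    refine re_nonneg_of_close N _ ((∑ i, l i • y i).2 (some ⟨r, hr⟩)) ?_
    rw [mul_comm, ← le_div_iff₀ hQpos] at h1
    refine h1.trans ?_
    rw [div_le_div_iff₀ hQpos (by norm_num)]
    linarith
  · intro l hl l' hl' heq
    rw [← hfst, ← hfst, ← sub_eq_zero, ← Int.cast_sub, ZMod.intCast_zmod_eq_zero_iff_dvd] at heq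
    obtain ⟨q, hq⟩ := heq
    apply hinj
    rw [← sub_eq_zero]
    ext o
    have h1 : ‖(∑ i, l i • e i - ∑ i, l' i • e i) o‖ ≤ 2 * C := by
      refine (norm_le_pi_norm _ o).trans ((norm_sub_le _ _).trans ?_)
      linarith [hbd l hl, hbd l' hl']
    have h2 : (∑ i, l i • e i - ∑ i, l' i • e i) o =
        Q * ((q * ρ o - ((∑ i, l i • y i).2 o - (∑ i, l' i • y i).2 o) : ℤ) : ℝ) := by
      rw [← hlin, ← hlin, ← map_sub, hι]
      rw [Prod.fst_sub, hq]
      have hN0 := hNpos.ne'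
      push_cast
      simp only [Prod.snd_sub, Pi.sub_apply]
      push_cast
      field_simp
    rw [h2] at h1 ⊢
    rw [Real.norm_eq_abs, abs_mul, abs_of_pos hQpos] at h1
    have h3 : |((q * ρ o - ((∑ i, l i • y i).2 o - (∑ i, l' i • y i).2 o) : ℤ) : ℝ)| < 1 := by
      by_contra h4
      push Not at h4
      have : (0 : ℝ) ≤ C := by positivity
      nlinarith
    have h4 : |q * ρ o - ((∑ i, l i • y i).2 o - (∑ i, l' i • y i).2 o)| < 1 := by
      exact_mod_cast h3
    rw [Int.abs_lt_one_iff] at h4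
    rw [h4]; simp
  · -- counting
    have hQ0 : 0 < Q := by omega
    let φ : ZMod N → Option R → ℝ := fun t o => Int.fract (((t.val * ρ o : ℤ) : ℝ) / N)
    have hg : ∀ t o, ⌊Q * φ t o⌋₊ < Q := by
      intro t o
      rw [Nat.floor_lt (mul_nonneg hQpos.le (Int.fract_nonneg _))]
      have := Int.fract_lt_one (((t.val * ρ o : ℤ) : ℝ) / N)
      have h2 : φ t o < 1 := this
      nlinarith
    let g : ZMod N → (Option R → Fin Q) := fun t o => ⟨⌊Q * φ t o⌋₊, hg t o⟩
    have hcardT : (Finset.univ : Finset (Option R → Fin Q)).card = Q ^ (R.card + 1) := by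
      simp
    obtain ⟨c, -, hc⟩ := Finset.exists_le_card_fiber_of_nsmul_le_card_of_maps_to
      (s := (Finset.univ : Finset (ZMod N))) (t := (Finset.univ : Finset (Option R → Fin Q)))
      (f := g) (b := (N : ℚ) / Q ^ (R.card + 1)) (fun _ _ => Finset.mem_univ _)
      ⟨fun _ => ⟨0, hQ0⟩, Finset.mem_univ _⟩
      (by
        rw [hcardT, Finset.card_univ, ZMod.card, nsmul_eq_mul]
        push_cast
        rw [mul_div_cancel₀]
        have : (Q : ℚ) ≠ 0 := by exact_mod_cast hQ0.ne'
        positivity)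
    set S := Finset.univ.filter fun t => g t = c with hS
    have hQq : (0 : ℚ) < Q := by exact_mod_cast hQ0
    rw [div_le_iff₀ (by positivity)] at hc
    have hc' : N ≤ S.card * Q ^ (R.card + 1) := by exact_mod_cast hc
    have hSne : S.Nonempty := by
      rw [← Finset.card_pos]
      by_contra h0
      have : S.card = 0 := by omega
      rw [this, zero_mul] at hc'
      exact NeZero.ne N (by omega)
    obtain ⟨t₀, ht₀⟩ := hSne
    have hex : ∀ t, ∃ l : Fin m → ℤ, t ∈ S → l ∈ box L ∧
        ∀ o, ∑ i, (l i • e i) o = Q * (φ t o - φ t₀ o) := by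
      intro t
      by_cases ht : t ∈ S
      swap
      · exact ⟨0, fun h => absurd h ht⟩
      let Y : ℤ × (Option R → ℤ) := ((t.val : ℤ) - t₀.val,
        fun o => ⌊((t.val * ρ o : ℤ) : ℝ) / N⌋ - ⌊((t₀.val * ρ o : ℤ) : ℝ) / N⌋)
      have hY : ∀ o, ι Y o = Q * (φ t o - φ t₀ o) := by
        intro o
        rw [hι]
        simp only [Y, φ, Int.fract]
        push_cast
        ring
      have hYn : ‖ι Y‖ ≤ 1 := by
        rw [pi_norm_le_iff_of_nonneg zero_le_one]
        intro o
        rw [hY, Real.norm_eq_abs]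
        have h1 : g t o = g t₀ o := by
          rw [(Finset.mem_filter.mp ht).2, (Finset.mem_filter.mp ht₀).2]
        have h2 : ⌊Q * φ t o⌋₊ = ⌊Q * φ t₀ o⌋₊ := congrArg Fin.val h1
        have ha := Nat.floor_le (mul_nonneg hQpos.le (Int.fract_nonneg
          (((t.val * ρ o : ℤ) : ℝ) / N)))
        have hb := Nat.floor_le (mul_nonneg hQpos.le (Int.fract_nonneg
          (((t₀.val * ρ o : ℤ) : ℝ) / N)))
        have ha' := Nat.lt_floor_add_one (Q * φ t o)
        have hb' := Nat.lt_floor_add_one (Q * φ t₀ o)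
        change (⌊Q * φ t o⌋₊ : ℝ) ≤ Q * φ t o at ha
        change (⌊Q * φ t₀ o⌋₊ : ℝ) ≤ Q * φ t₀ o at hb
        rw [h2] at ha ha'
        rw [abs_le]; constructor <;> linarith
      obtain ⟨l, hl, hx⟩ := hcov (ι Y) ⟨Y, rfl⟩ hYn
      refine ⟨l, fun _ => ⟨mem_box.mpr hl, fun o => ?_⟩⟩
      rw [← hY, hx, Finset.sum_apply]
    choose l hl using hex
    have hcard : S.card ≤ (box L).card := by
      refine Finset.card_le_card_of_injOn l (fun t ht => (hl t ht).1) ?_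
      intro t ht s hs hts
      have h1 := (hl t ht).2 none
      have h2 := (hl s hs).2 none
      rw [hts, h2] at h1
      have h3 : φ s none = φ t none := by
        have := mul_left_cancel₀ hQpos.ne' h1
        linarith
      have hval : ∀ t : ZMod N, φ t none = (t.val : ℝ) / N := by
        intro t
        simp only [φ, ρ, Option.elim, mul_one, Int.cast_natCast]
        rw [Int.fract_eq_self]
        refine ⟨by positivity, ?_⟩
        rw [div_lt_one hNpos]
        exact_mod_cast ZMod.val_lt t
      rw [hval, hval, div_left_inj' hNpos.ne'] at h3
      exact (ZMod.val_injective N (by exact_mod_cast h3)).symm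
    rw [card_box] at hcard
    calc N ≤ S.card * Q ^ (R.card + 1) := hc'
      _ ≤ (∏ i, (2 * L i + 1)) * Q ^ (k + 1) := by
          gcongr
      _ = _ := by ring

end FZ


namespace FZ

lemma plu (K : ℕ) (A : Finset (ℤ × ℤ)) (hA : A.Nonempty) (h : (A + A).card ≤ K * A.card)
    (m n : ℕ) : (m • A - n • A).card ≤ K ^ (m + n) * A.card := by
  have h1 := Finset.pluennecke_ruzsa_inequality_nsmul_sub_nsmul_add hA A m n
  have h2 : ((A + A).card : ℚ≥0) / A.card ≤ K := by
    have : (0 : ℚ≥0) < A.card := by exact_mod_cast hA.card_pos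
    rw [div_le_iff₀ this]
    exact_mod_cast h
  have h3 : ((m • A - n • A).card : ℚ≥0) ≤ K ^ (m + n) * A.card :=
    h1.trans (by gcongr)
  exact_mod_cast h3

theorem gap_in (K : ℕ) : ∃ d c : ℕ, ∀ A : Finset (ℤ × ℤ), A.Nonempty →
    (A + A).card ≤ K * A.card →
    ∃ (m : ℕ) (w : Fin m → ℤ × ℤ) (L : Fin m → ℕ), m ≤ d ∧ (∀ i, 1 ≤ L i) ∧
      (∀ l ∈ box L, ∑ i, l i • w i ∈ 2 • A - 2 • A) ∧
      (∀ l ∈ box L, ∀ l' ∈ box L, ∑ i, l i • w i = ∑ i, l' i • w i → l = l') ∧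
      A.card ≤ c * ∏ i, (2 * L i + 1) := by
  classical
  set D : ℕ := 12 * K ^ 12 with hD
  obtain ⟨M, hM⟩ := bohr_gap (2 * D ^ 2)
  refine ⟨2 * D ^ 2 + 1, M, fun A hA hAA => ?_⟩
  obtain ⟨A₁, hA₁, hcard, π, hπ⟩ := modeling A hA
  set N : ℕ := (6 • A - 6 • A).card with hN
  have hNle : N ≤ K ^ 12 * A.card := plu K A hA hAA 6 6
  have hAN : A.card ≤ N := by
    obtain ⟨a, ha⟩ := hA
    refine Finset.card_le_card_of_injOn (fun x => (6 • x - 6 • a)) ?_ ?_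
    · intro x hx
      have h1 : 6 • x ∈ 6 • A := Finset.nsmul_mem_nsmul hx
      have h2 : 6 • a ∈ 6 • A := Finset.nsmul_mem_nsmul ha
      exact Finset.sub_mem_sub h1 h2
    · intro x _ y _ hxy
      simp only [sub_left_inj] at hxy
      have h1 := congrArg Prod.fst hxy
      have h2 := congrArg Prod.snd hxy
      refine Prod.ext ?_ ?_
      · simpa using h1
      · simpa using h2
  have hN0 : NeZero N := ⟨by have := hA.card_pos; omega⟩
  have hA₁ne : A₁.Nonempty := by
    rw [← Finset.card_pos]; have := hA.card_pos; omega
  obtain ⟨o, ho⟩ := hA₁ne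
  let q : ℤ × ℤ → ZMod N := fun a => ((π a : ℤ) : ZMod N)
  have rel : ∀ a₁ ∈ A₁, ∀ a₂ ∈ A₁, ∀ a₃ ∈ A₁, ∀ a₄ ∈ A₁, ∀ a₅ ∈ A₁, ∀ a₆ ∈ A₁,
      ∀ b₁ ∈ A₁, ∀ b₂ ∈ A₁, ∀ b₃ ∈ A₁, ∀ b₄ ∈ A₁, ∀ b₅ ∈ A₁, ∀ b₆ ∈ A₁,
      (q a₁ + q a₂ + q a₃ + q a₄ + q a₅ + q a₆ = q b₁ + q b₂ + q b₃ + q b₄ + q b₅ + q b₆ ↔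
        a₁ + a₂ + a₃ + a₄ + a₅ + a₆ = b₁ + b₂ + b₃ + b₄ + b₅ + b₆) := by
    intro a₁ h₁ a₂ h₂ a₃ h₃ a₄ h₄ a₅ h₅ a₆ h₆ b₁ g₁ b₂ g₂ b₃ g₃ b₄ g₄ b₅ g₅ b₆ g₆
    have h := hπ ![a₁, a₂, a₃, a₄, a₅, a₆] ![b₁, b₂, b₃, b₄, b₅, b₆]
      (by intro i; fin_cases i <;> assumption) (by intro i; fin_cases i <;> assumption)
    rw [← ZMod.intCast_zmod_eq_zero_iff_dvd, Int.cast_sub, sub_eq_zero, Fin.sum_univ_six,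
      Fin.sum_univ_six, Fin.sum_univ_six, Fin.sum_univ_six] at h
    push_cast at h
    exact h
  let A' : Finset (ZMod N) := A₁.image q
  have hA'card : A'.card = A₁.card := by
    refine Finset.card_image_of_injOn fun a ha b hb hab => ?_
    have := (rel a ha o ho o ho o ho o ho o ho b hb o ho o ho o ho o ho o ho).mp (by rw [hab])
    simpa using this
  obtain ⟨R, hRc, hR⟩ := bogolyubov N A' ⟨q o, Finset.mem_image_of_mem _ ho⟩ D (by
    rw [hA'card, hD]
    calc N ≤ K ^ 12 * A.card := hNle
      _ ≤ K ^ 12 * (12 * A₁.card) := Nat.mul_le_mul_left _ hcard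
      _ = _ := by ring)
  obtain ⟨m, t, L, hm, hL, hbohr, hinj, hcount⟩ := hM N R hRc
  let S : ZMod N → ℤ × ℤ → Prop := fun x g => ∃ a ∈ A₁, ∃ b ∈ A₁, ∃ c ∈ A₁, ∃ d ∈ A₁,
    x = q a + q b - q c - q d ∧ g = a + b - c - d
  have S0 : S 0 0 := ⟨o, ho, o, ho, o, ho, o, ho, by ring, by ring⟩
  have Sneg : ∀ x g, S x g → S (-x) (-g) := by
    rintro x g ⟨a, ha, b, hb, c, hc, d, hd, rfl, rfl⟩
    exact ⟨c, hc, d, hd, a, ha, b, hb, by ring, by ring⟩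
  have Sadd : ∀ x y g h k, S x g → S y h → S (x + y) k → k = g + h := by
    rintro x y g h k ⟨a, ha, b, hb, c, hc, d, hd, rfl, rfl⟩
      ⟨a', ha', b', hb', c', hc', d', hd', rfl, rfl⟩
      ⟨a'', ha'', b'', hb'', c'', hc'', d'', hd'', h1, rfl⟩
    have := (rel a ha b hb a' ha' b' hb' c'' hc'' d'' hd'' c hc d hd c' hc' d' hd' a'' ha''
      b'' hb'').mp (by linear_combination h1)
    linear_combination -this
  have Sinj : ∀ x y g, S x g → S y g → x = y := by
    rintro x y g ⟨a, ha, b, hb, c, hc, d, hd, rfl, rfl⟩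
      ⟨a', ha', b', hb', c', hc', d', hd', rfl, h1⟩
    have := (rel a ha b hb c' hc' d' hd' o ho o ho c hc d hd a' ha' b' hb' o ho o ho).mpr
      (by linear_combination h1)
    linear_combination this
  have hex : ∀ l ∈ box L, ∃ g, S (∑ i, l i • t i) g := by
    intro l hl
    obtain ⟨a, ha, b, hb, c, hc, d, hd, h⟩ := hR _ (hbohr l hl)
    obtain ⟨a', ha', rfl⟩ := Finset.mem_image.mp ha
    obtain ⟨b', hb', rfl⟩ := Finset.mem_image.mp hb
    obtain ⟨c', hc', rfl⟩ := Finset.mem_image.mp hc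
    obtain ⟨d', hd', rfl⟩ := Finset.mem_image.mp hd
    exact ⟨_, a', ha', b', hb', c', hc', d', hd', h, rfl⟩
  have hsingle : ∀ i (s : ℤ), ∑ j, (Pi.single i s : Fin m → ℤ) j • t j = s • t i := by
    intro i s
    rw [Finset.sum_eq_single i (fun j _ hj => by rw [Pi.single_eq_of_ne hj, zero_smul])
      (fun h => absurd (Finset.mem_univ i) h), Pi.single_eq_same]
  have hw : ∀ i, ∃ g, S (t i) g := by
    intro i
    obtain ⟨g, hg⟩ := hex (Pi.single i 1) (mem_box.mpr fun j => by
      have := hL j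
      by_cases h : j = i
      · subst h; simp; exact_mod_cast this
      · simp [Pi.single_eq_of_ne h])
    rw [hsingle, one_smul] at hg
    exact ⟨g, hg⟩
  choose w hw using hw
  have hsinglew : ∀ i (s : ℤ), ∑ j, (Pi.single i s : Fin m → ℤ) j • w j = s • w i := by
    intro i s
    rw [Finset.sum_eq_single i (fun j _ hj => by rw [Pi.single_eq_of_ne hj, zero_smul])
      (fun h => absurd (Finset.mem_univ i) h), Pi.single_eq_same]
  have hmain : ∀ (n : ℕ) (l : Fin m → ℤ), l ∈ box L → ∑ i, (l i).natAbs = n →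
      S (∑ i, l i • t i) (∑ i, l i • w i) := by
    intro n
    induction n with
    | zero =>
      intro l _ hl0
      have : ∀ i, l i = 0 := fun i => by
        have := (Finset.sum_eq_zero_iff.mp hl0) i (Finset.mem_univ i)
        exact Int.natAbs_eq_zero.mp this
      simp only [this, zero_smul, Finset.sum_const_zero]
      exact S0
    | succ n ih =>
      intro l hl hln
      obtain ⟨i, hi⟩ : ∃ i, l i ≠ 0 := by
        by_contra h
        push Not at h
        simp [h] at hln
      obtain ⟨s, hs, hsl⟩ : ∃ s : ℤ, (s = 1 ∨ s = -1) ∧ (l i - s).natAbs + 1 = (l i).natAbs := by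
        rcases lt_or_gt_of_ne hi with h | h
        · exact ⟨-1, Or.inr rfl, by omega⟩
        · exact ⟨1, Or.inl rfl, by omega⟩
      set l' : Fin m → ℤ := l - Pi.single i s with hl'
      have hl'i : l' i = l i - s := by simp [hl']
      have hl'j : ∀ j, j ≠ i → l' j = l j := fun j hj => by simp [hl', Pi.single_eq_of_ne hj]
      have hl'box : l' ∈ box L := by
        rw [mem_box] at hl ⊢
        intro j
        by_cases hj : j = i
        · subst hj
          have := hl j
          rw [hl'i]
          rw [Int.abs_eq_natAbs] at this ⊢
          omega
        · rw [hl'j j hj]; exact hl j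
      have hl'n : ∑ j, (l' j).natAbs = n := by
        have h1 := Finset.add_sum_erase Finset.univ (fun j => (l j).natAbs) (Finset.mem_univ i)
        have h2 := Finset.add_sum_erase Finset.univ (fun j => (l' j).natAbs) (Finset.mem_univ i)
        have h3 : ∑ j ∈ Finset.univ.erase i, (l' j).natAbs =
            ∑ j ∈ Finset.univ.erase i, (l j).natAbs :=
          Finset.sum_congr rfl fun j hj => by rw [hl'j j (Finset.ne_of_mem_erase hj)]
        simp only [h3, hl'i] at h1 h2
        omega
      have hS' := ih l' hl'box hl'n
      have hll : l = l' + Pi.single i s := by rw [hl']; abel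
      have hxt : ∑ j, l j • t j = ∑ j, l' j • t j + s • t i := by
        rw [← hsingle, ← Finset.sum_add_distrib]
        conv_lhs => rw [hll]
        exact Finset.sum_congr rfl fun j _ => by rw [Pi.add_apply, add_smul]
      have hxw : ∑ j, l j • w j = ∑ j, l' j • w j + s • w i := by
        rw [← hsinglew, ← Finset.sum_add_distrib]
        conv_lhs => rw [hll]
        exact Finset.sum_congr rfl fun j _ => by rw [Pi.add_apply, add_smul]
      have hSs : S (s • t i) (s • w i) := by
        rcases hs with rfl | rfl
        · rw [one_smul, one_smul]; exact hw i
        · rw [neg_smul, neg_smul, one_smul, one_smul]; exact Sneg _ _ (hw i)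
      obtain ⟨g, hg⟩ := hex l hl
      have hgS := hg
      rw [hxt] at hgS
      have hgg := Sadd _ _ _ _ _ hS' hSs hgS
      rw [hxw, ← hgg]
      exact hg
  refine ⟨m, w, L, hm, hL, ?_, ?_, hAN.trans hcount⟩
  · intro l hl
    obtain ⟨a, ha, b, hb, c, hc, d, hd, -, h⟩ := hmain _ l hl rfl
    rw [h, two_nsmul, sub_sub]
    exact Finset.sub_mem_sub (Finset.add_mem_add (hA₁ ha) (hA₁ hb))
      (Finset.add_mem_add (hA₁ hc) (hA₁ hd))
  · intro l hl l' hl' h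
    have h1 := hmain _ l hl rfl
    have h2 := hmain _ l' hl' rfl
    rw [h] at h1
    exact hinj l hl l' hl' (Sinj _ _ _ h1 h2)

theorem freiman_sym (K : ℕ) : ∃ d F : ℕ, ∀ A : Finset (ℤ × ℤ), A.Nonempty →
    (A + A).card ≤ K * A.card →
    ∃ (m : ℕ) (v : Fin m → ℤ × ℤ) (L : Fin m → ℕ), m ≤ d ∧
      (∀ l ∈ box L, ∀ l' ∈ box L, ∑ i, l i • v i = ∑ i, l' i • v i → l = l') ∧
      (∀ a ∈ A, ∃ l ∈ box L, a = ∑ i, l i • v i) ∧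
      ∏ i, (2 * L i + 1) ≤ F * A.card := by
  classical
  obtain ⟨d, c, hdc⟩ := gap_in K
  obtain ⟨G, hG⟩ := make_proper (d + K ^ 5 * c)
  refine ⟨d + K ^ 5 * c, G * (2 ^ d * 3 ^ (K ^ 5 * c) * K ^ 4), fun A hA hAA => ?_⟩
  obtain ⟨m, w, L, hm, hL, hmem, hinj, hcard⟩ := hdc A hA hAA
  let Q : Finset (ℤ × ℤ) := (box L).image fun l => ∑ i, l i • w i
  have hQcard : Q.card = ∏ i, (2 * L i + 1) := by
    rw [← card_box]
    exact Finset.card_image_of_injOn fun l hl l' hl' h => hinj l hl l' hl' h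
  have hQsub : Q ⊆ 2 • A - 2 • A := by
    intro x hx
    obtain ⟨l, hl, rfl⟩ := Finset.mem_image.mp hx
    exact hmem l hl
  have hQne : Q.Nonempty := by
    rw [← Finset.card_pos, hQcard]; positivity
  have hAQ : (A + Q).card ≤ K ^ 5 * c * Q.card := by
    have h1 : A + Q ⊆ 3 • A - 2 • A := by
      rw [show 3 • A = A + 2 • A from succ_nsmul' A 2, add_sub_assoc]
      exact Finset.add_subset_add_left hQsub
    calc (A + Q).card ≤ K ^ (3 + 2) * A.card := (Finset.card_le_card h1).trans (plu K A hA hAA 3 2)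
      _ ≤ K ^ 5 * (c * Q.card) := by rw [hQcard]; exact Nat.mul_le_mul_left _ hcard
      _ = _ := by ring
  obtain ⟨X, hXA, hXc, hcov⟩ := Finset.ruzsa_covering_add (K := ((K ^ 5 * c : ℕ) : ℝ)) hQne
    (by exact_mod_cast hAQ : ((A + Q).card : ℝ) ≤ ((K ^ 5 * c : ℕ) : ℝ) * Q.card)
  have hXc' : X.card ≤ K ^ 5 * c := by exact_mod_cast hXc
  let xs : Fin X.card → ℤ × ℤ := fun i => (X.equivFin.symm i : ℤ × ℤ)
  let v : Fin (m + X.card) → ℤ × ℤ := Fin.append w xs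
  let L₁ : Fin (m + X.card) → ℕ := Fin.append (fun i => 2 * L i) (fun _ => 1)
  obtain ⟨m', v', L', h1, h2, h3, h4⟩ := hG (m + X.card) (by omega) v L₁ (by
    intro i
    refine Fin.addCases (fun i => ?_) (fun i => ?_) i
    · simp only [L₁, Fin.append_left]; have := hL i; omega
    · simp only [L₁, Fin.append_right]; exact le_rfl)
  refine ⟨m', v', L', h1, h2, ?_, ?_⟩
  · intro a ha
    obtain ⟨x, hx, y, hy, rfl⟩ := Finset.mem_add.mp (hcov ha)
    obtain ⟨y₁, hy₁, y₂, hy₂, rfl⟩ := Finset.mem_sub.mp hy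
    obtain ⟨l₁, hl₁, rfl⟩ := Finset.mem_image.mp hy₁
    obtain ⟨l₂, hl₂, rfl⟩ := Finset.mem_image.mp hy₂
    let j : Fin X.card := X.equivFin ⟨x, hx⟩
    have hj : xs j = x := by simp [xs, j]
    let l : Fin (m + X.card) → ℤ := Fin.append (l₁ - l₂) (Pi.single j 1)
    obtain ⟨l', hl', hll'⟩ := h3 l (mem_box.mpr fun i => by
      refine Fin.addCases (fun i => ?_) (fun i => ?_) i
      · simp only [l, L₁, Fin.append_left, Pi.sub_apply]
        have e1 := mem_box.mp hl₁ i
        have e2 := mem_box.mp hl₂ i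
        have e3 := abs_sub (l₁ i) (l₂ i)
        push_cast
        linarith
      · simp only [l, L₁, Fin.append_right]
        by_cases h : i = j
        · subst h; simp
        · simp [Pi.single_eq_of_ne h])
    refine ⟨l', hl', ?_⟩
    rw [← hll', Fin.sum_univ_add]
    simp only [l, v, Fin.append_left, Fin.append_right]
    rw [Finset.sum_eq_single j (fun i _ hi => by rw [Pi.single_eq_of_ne hi, zero_smul])
      (fun h => absurd (Finset.mem_univ j) h), Pi.single_eq_same, one_smul, hj]
    simp only [Pi.sub_apply, sub_smul, Finset.sum_sub_distrib]
    abel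
  · have hP : ∏ i, (2 * L₁ i + 1) ≤ 2 ^ d * 3 ^ (K ^ 5 * c) * K ^ 4 * A.card := by
      rw [Fin.prod_univ_add]
      simp only [L₁, Fin.append_left, Fin.append_right]
      have e1 : ∏ i, (2 * (2 * L i) + 1) ≤ 2 ^ d * (K ^ 4 * A.card) := by
        calc ∏ i, (2 * (2 * L i) + 1) ≤ ∏ i, (2 * (2 * L i + 1)) := by
              gcongr with i; omega
          _ = 2 ^ m * Q.card := by rw [Finset.prod_mul_distrib, hQcard]; simp
          _ ≤ 2 ^ d * (K ^ (2 + 2) * A.card) := by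
              gcongr
              · norm_num
              · exact (Finset.card_le_card hQsub).trans (plu K A hA hAA 2 2)
      have e2 : ∏ _i : Fin X.card, (2 * 1 + 1) ≤ 3 ^ (K ^ 5 * c) := by
        simp only [Finset.prod_const, Finset.card_univ, Fintype.card_fin]
        exact Nat.pow_le_pow_right (by norm_num) hXc'
      calc _ ≤ 2 ^ d * (K ^ 4 * A.card) * 3 ^ (K ^ 5 * c) := Nat.mul_le_mul e1 e2
        _ = _ := by ring
    calc _ ≤ G * _ := h4
      _ ≤ G * _ := Nat.mul_le_mul_left _ hP
      _ = _ := by ring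

end FZ

/-- Green–Ruzsa / Freiman theorem in `ℤ²`: for every `K > 0` there exist constants
`d = d(K)` and `f = f(K)` such that every finite nonempty `A ⊆ ℤ²` with `|A + A| ≤ K·|A|`
is contained in a proper arithmetic progression
`P = {v₀ + ℓ₁v₁ + ⋯ + ℓₘvₘ : 0 ≤ ℓⱼ < Lⱼ}` of dimension `m ≤ d` (all the sums being
pairwise distinct, so `|P| = L₁⋯Lₘ`) with `L₁⋯Lₘ ≤ f·|A|`. -/
theorem stmt_17 (K : ℝ) (hK : 0 < K) :
    ∃ d : ℕ, ∃ f : ℝ,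
      ∀ A : Finset (ℤ × ℤ), A.Nonempty → ((A + A).card : ℝ) ≤ K * (A.card : ℝ) →
        ∃ (m : ℕ) (v₀ : ℤ × ℤ) (v : Fin m → ℤ × ℤ) (L : Fin m → ℕ),
          1 ≤ m ∧ m ≤ d ∧ (∀ j, 0 < L j) ∧
          -- properness: all the sums in the representation are pairwise distinct
          (∀ ℓ ℓ' : Fin m → ℕ, (∀ j, ℓ j < L j) → (∀ j, ℓ' j < L j) →
            (v₀ + ∑ j, (ℓ j : ℤ) • v j) = (v₀ + ∑ j, (ℓ' j : ℤ) • v j) → ℓ = ℓ') ∧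
          -- `A` is contained in `P`
          (∀ a ∈ A, ∃ ℓ : Fin m → ℕ, (∀ j, ℓ j < L j) ∧
            a = v₀ + ∑ j, (ℓ j : ℤ) • v j) ∧
          -- the size of `P` is at most `f·|A|`
          ((∏ j, L j : ℕ) : ℝ) ≤ f * (A.card : ℝ) := by
  obtain ⟨d, F, h⟩ := FZ.freiman_sym ⌈K⌉₊
  refine ⟨d + 1, F, fun A hA hAA => ?_⟩
  have hAA' : (A + A).card ≤ ⌈K⌉₊ * A.card := by
    have : ((A + A).card : ℝ) ≤ (⌈K⌉₊ : ℝ) * A.card :=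
      hAA.trans (by gcongr; exact Nat.le_ceil K)
    exact_mod_cast this
  obtain ⟨m, v, L, hm, hinj, hcov, hcard⟩ := h A hA hAA'
  refine ⟨m + 1, -∑ i, (L i : ℤ) • v i, Fin.cons 0 v, Fin.cons 1 (fun i => 2 * L i + 1),
    by omega, by omega, ?_, ?_, ?_, ?_⟩
  · intro j; refine Fin.cases ?_ (fun j => ?_) j <;> simp
  · intro ℓ ℓ' hℓ hℓ' heq
    rw [add_right_inj, Fin.sum_univ_succ, Fin.sum_univ_succ] at heq
    simp only [Fin.cons_zero, Fin.cons_succ, smul_zero, zero_add] at heq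
    have key := hinj (fun i => (ℓ i.succ : ℤ) - L i)
      (FZ.mem_box.mpr fun i => by
        have := hℓ i.succ
        simp only [Fin.cons_succ] at this
        rw [abs_le]; omega)
      (fun i => (ℓ' i.succ : ℤ) - L i)
      (FZ.mem_box.mpr fun i => by
        have := hℓ' i.succ
        simp only [Fin.cons_succ] at this
        rw [abs_le]; omega)
      (by simp only [sub_smul, Finset.sum_sub_distrib, heq])
    ext j
    refine Fin.cases ?_ (fun j => ?_) j
    · have h1 := hℓ 0
      have h2 := hℓ' 0
      simp only [Fin.cons_zero] at h1 h2
      omega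
    · have : (ℓ j.succ : ℤ) - L j = (ℓ' j.succ : ℤ) - L j := congrFun key j
      omega
  · intro a ha
    obtain ⟨l, hl, rfl⟩ := hcov a ha
    rw [FZ.mem_box] at hl
    refine ⟨Fin.cons 0 (fun i => (l i + L i).toNat), ?_, ?_⟩
    · intro j
      refine Fin.cases ?_ (fun j => ?_) j
      · simp
      · simp only [Fin.cons_succ]
        have := abs_le.mp (hl j)
        omega
    · rw [Fin.sum_univ_succ]
      simp only [Fin.cons_zero, Fin.cons_succ, smul_zero, zero_add]
      have : ∀ i, (((l i + L i).toNat : ℕ) : ℤ) = l i + L i := fun i => by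
        have := abs_le.mp (hl i)
        omega
      simp only [this, add_smul, Finset.sum_add_distrib]
      abel
  · rw [Fin.prod_univ_succ]
    simp only [Fin.cons_zero, Fin.cons_succ, one_mul]
    exact_mod_cast hcard
end

section
/- Let G be an abelian group, K ≥ 1 a real number, and let A, B ⊂ G be finite nonempty sets with |A| = |B| and |A + B| ≤ K·|A|. Then |A + A + B| ≤ K³·|A + B|. -/
open scoped Pointwise

lemma petridis_aux {G : Type*} [AddCommGroup G] [DecidableEq G] (A B : Finset G)
    (hB : B.Nonempty) : ∃ X ⊆ B, X.Nonempty ∧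
      ∀ C : Finset G, (C + X + A).card * B.card ≤ (B + A).card * (C + X).card := by
  have hB' : B ∈ B.powerset.erase ∅ :=
    Finset.mem_erase_of_ne_of_mem hB.ne_empty (Finset.mem_powerset_self _)
  obtain ⟨U, hU, hmin⟩ := Finset.exists_min_image (B.powerset.erase ∅)
    (fun U ↦ ((U + A).card : ℚ) / (U.card : ℚ)) ⟨B, hB'⟩
  rw [Finset.mem_erase, Finset.mem_powerset, ← Finset.nonempty_iff_ne_empty] at hU
  have key : ∀ A' ⊆ B, (U + A).card * A'.card ≤ (A' + A).card * U.card := by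
    intro A' hA'
    obtain rfl | hne := A'.eq_empty_or_nonempty
    · simp
    have h1 : (0 : ℚ) < U.card := by exact_mod_cast hU.1.card_pos
    have h2 : (0 : ℚ) < A'.card := by exact_mod_cast hne.card_pos
    exact_mod_cast (div_le_div_iff₀ h1 h2).1
      (hmin A' (Finset.mem_erase_of_ne_of_mem hne.ne_empty (Finset.mem_powerset.2 hA')))
  refine ⟨U, hU.2, hU.1, fun C ↦ ?_⟩
  have h1 := Finset.pluennecke_petridis_inequality_add (A := U) (B := A) C
    (fun A' hA' ↦ key A' (hA'.trans hU.2))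
  have h2 := key B subset_rfl
  refine Nat.le_of_mul_le_mul_right ?_ hU.1.card_pos
  calc (C + U + A).card * B.card * U.card = (C + U + A).card * U.card * B.card := by ring
    _ ≤ (U + A).card * (C + U).card * B.card := by gcongr
    _ = (U + A).card * B.card * (C + U).card := by ring
    _ ≤ (B + A).card * U.card * (C + U).card := by gcongr
    _ = _ := by ring

/-- Let `G` be an abelian group, `K ≥ 1`, and `A, B ⊆ G` finite nonempty sets with
`|A| = |B|` and `|A + B| ≤ K·|A|`. Then `|A + A + B| ≤ K³·|A + B|`. -/
theorem stmt_19 {G : Type*} [AddCommGroup G] [DecidableEq G] (K : ℝ) (hK : 1 ≤ K)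
    (A B : Finset G) (hA : A.Nonempty) (hB : B.Nonempty) (hcard : A.card = B.card)
    (h : ((A + B).card : ℝ) ≤ K * (A.card : ℝ)) :
    ((A + A + B).card : ℝ) ≤ K ^ 3 * ((A + B).card : ℝ) := by
  obtain ⟨X, hXB, hX, hXC⟩ := petridis_aux A B hB
  obtain ⟨Y, hYA, hY, hYC⟩ := petridis_aux B A hA
  have e1 := hXC (A + B)
  have e2 := hXC B
  have e3 := hYC B
  have r1 : A + B + X + A = (A + A + B) + X := by abel
  have r2 : B + X + A = A + B + X := by abel
  have r3 : B + Y + B = (B + B) + Y := by abel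
  rw [r1, ← hcard, add_comm B A] at e1
  rw [r2, ← hcard, add_comm B A] at e2
  rw [r3] at e3
  have f1 : (A + A + B).card ≤ ((A + A + B) + X).card := Finset.card_le_card_add_right hX
  have f2 : (B + X).card ≤ (B + B).card :=
    Finset.card_le_card (Finset.add_subset_add_left hXB)
  have f3 : (B + B).card ≤ ((B + B) + Y).card := Finset.card_le_card_add_right hY
  have f4 : (B + Y).card ≤ (A + B).card := by
    rw [add_comm B Y]; exact Finset.card_le_card (Finset.add_subset_add_right hYA)
  have main : (A + A + B).card * A.card ^ 3 ≤ (A + B).card ^ 4 := by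
    calc (A + A + B).card * A.card ^ 3
        ≤ ((A + A + B) + X).card * A.card ^ 3 := by gcongr
      _ = (((A + A + B) + X).card * A.card) * A.card ^ 2 := by ring
      _ ≤ ((A + B).card * (A + B + X).card) * A.card ^ 2 := by gcongr
      _ = (A + B).card * ((A + B + X).card * A.card) * A.card := by ring
      _ ≤ (A + B).card * ((A + B).card * (B + X).card) * A.card := by gcongr
      _ ≤ (A + B).card * ((A + B).card * ((B + B) + Y).card) * A.card := by
        have f23 := f2.trans f3
        exact Nat.mul_le_mul_right _ (Nat.mul_le_mul_left _ (Nat.mul_le_mul_left _ f23))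
      _ = (A + B).card ^ 2 * (((B + B) + Y).card * A.card) := by ring
      _ ≤ (A + B).card ^ 2 * ((A + B).card * (B + Y).card) := by gcongr
      _ ≤ (A + B).card ^ 2 * ((A + B).card * (A + B).card) := by gcongr
      _ = _ := by ring
  have main' : ((A + A + B).card : ℝ) * (A.card : ℝ) ^ 3 ≤ ((A + B).card : ℝ) ^ 4 := by
    exact_mod_cast main
  have hpos : (0 : ℝ) < A.card := by exact_mod_cast hA.card_pos
  refine le_of_mul_le_mul_right ?_ (pow_pos hpos 3)
  calc _ ≤ ((A + B).card : ℝ) ^ 4 := main'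
    _ = ((A + B).card : ℝ) ^ 3 * (A + B).card := by ring
    _ ≤ (K * A.card) ^ 3 * (A + B).card := by gcongr
    _ = _ := by ring
end
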